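/- (Nikishin) Let ℓ ≥ 1 be an integer and let z be a negative integer with |z| > (4ℓ)^{ℓ(ℓ−1)}. Then the ℓ+1 real numbers 1, Li₁(1/z), Li₂(1/z), …, Li_ℓ(1/z) are linearly independent over ℚ. -/

import Mathlib

/-- The polylogarithm `Li_k(x) = ∑_{n ≥ 1} x^n / n^k`. -/
noncomputable def Li (k : ℕ) (x : ℝ) : ℝ := ∑' n : ℕ, x ^ (n + 1) / (n + 1 : ℝ) ^ k

open Finset PowerSeries in
/-- The beta integral at positive integers is at most the maximum of its integrand. -/
theorem exists_factorial_mul_prod_inv_le (s M : ℕ) :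
    ∃ x ∈ Set.Icc (0 : ℝ) 1,
      (M.factorial : ℝ) * ∏ m ∈ range (M + 1), ((s : ℝ) + m + 1)⁻¹ ≤ x ^ s * (1 - x) ^ M := by
  have hcont : Continuous fun x : ℝ => x ^ s * (1 - x) ^ M := by fun_prop
  obtain ⟨x, hx, hmax⟩ := (isCompact_Icc (a := (0 : ℝ)) (b := 1)).exists_isMaxOn
    ⟨0, by simp⟩ hcont.continuousOn
  refine ⟨x, hx, ?_⟩
  have hval : ∫ y in (0 : ℝ)..1, y ^ s * (1 - y) ^ M =
      (M.factorial : ℝ) * ∏ m ∈ range (M + 1), ((s : ℝ) + m + 1)⁻¹ := by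
    have h := Complex.betaIntegral_eval_nat_add_one_right (u := (s : ℂ) + 1)
      (by simp; positivity) M
    simp only [Complex.betaIntegral, add_sub_cancel_right, Complex.cpow_natCast] at h
    apply Complex.ofReal_injective
    rw [← intervalIntegral.integral_ofReal]
    push_cast
    rw [h, prod_inv_distrib, div_eq_mul_inv]
    congr 2
    exact prod_congr rfl fun m _ => by ring
  rw [← hval]
  calc ∫ y in (0 : ℝ)..1, y ^ s * (1 - y) ^ M
      ≤ ∫ _ in (0 : ℝ)..1, x ^ s * (1 - x) ^ M :=
        intervalIntegral.integral_mono_on zero_le_one (hcont.intervalIntegrable _ _)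
          (by simp) fun y hy => hmax hy
    _ = _ := by simp

/-- `f` is majorized coefficientwise by `c / (1 - X) ^ K`. -/
def IsMajorized (f : PowerSeries ℝ) (c : ℝ) (K : ℕ) : Prop :=
  ∀ k, |f.coeff k| ≤ c * (PowerSeries.mk (1 : ℕ → ℝ) ^ K).coeff k

namespace IsMajorized

open PowerSeries Finset

variable {f g : PowerSeries ℝ} {c d : ℝ} {K L : ℕ}

theorem mul (hf : IsMajorized f c K) (hg : IsMajorized g d L) :
    IsMajorized (f * g) (c * d) (K + L) := by
  intro k
  rw [coeff_mul, pow_add, coeff_mul, mul_sum]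
  refine (abs_sum_le_sum_abs _ _).trans (sum_le_sum fun p _ => ?_)
  rw [abs_mul]
  calc _ ≤ _ := mul_le_mul (hf p.1) (hg p.2) (abs_nonneg _) ((abs_nonneg _).trans (hf p.1))
    _ = _ := by ring

theorem one : IsMajorized 1 1 0 := by
  intro k
  simp only [pow_zero, one_mul, coeff_one]
  split_ifs <;> simp

theorem const (a : ℝ) : IsMajorized (C a) |a| 0 := by
  intro k
  simp only [pow_zero, coeff_one, coeff_C]
  split_ifs <;> simp

theorem pow (hf : IsMajorized f c K) (e : ℕ) : IsMajorized (f ^ e) (c ^ e) (K * e) := by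
  induction e with
  | zero => simpa using one
  | succ e ih =>
    rw [pow_succ, pow_succ, mul_add, mul_one]
    exact ih.mul hf

theorem prod_range {F : ℕ → PowerSeries ℝ} {c : ℕ → ℝ} {n : ℕ}
    (h : ∀ j < n, IsMajorized (F j) (c j) 1) :
    IsMajorized (∏ j ∈ range n, F j) (∏ j ∈ range n, c j) n := by
  induction n with
  | zero => simpa using one
  | succ n ih =>
    rw [prod_range_succ, prod_range_succ]
    exact (ih fun j hj => h j (by omega)).mul (h n (by omega))

theorem C_add_X {b : ℝ} (hb : 1 ≤ b) : IsMajorized (C b + X) b 1 := by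
  intro k
  have : |b| = b := abs_of_nonneg (by linarith)
  rcases k with _ | _ | k <;> simp [coeff_X, this, hb]
  linarith

theorem abs_coeff_le (hf : IsMajorized f c K) (hK : K ≠ 0) (k : ℕ) :
    |f.coeff k| ≤ c * ((K : ℝ) + k) ^ k := by
  have hc : 0 ≤ c := by
    obtain ⟨K, rfl⟩ := Nat.exists_eq_succ_of_ne_zero hK
    have := (abs_nonneg _).trans (hf 0)
    simpa [mk_one_pow_eq_mk_choose_add] using this
  refine (hf k).trans (mul_le_mul_of_nonneg_left ?_ hc)
  obtain ⟨K, rfl⟩ := Nat.exists_eq_succ_of_ne_zero hK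
  rw [Nat.succ_eq_add_one, mk_one_pow_eq_mk_choose_add, coeff_mk]
  calc ((Nat.choose (K + k) K : ℕ) : ℝ) = ((K + k).choose k : ℕ) := by
        rw [Nat.choose_symm_add]
    _ ≤ ((K + k : ℕ) : ℝ) ^ k := by exact_mod_cast Nat.choose_le_pow _ _
    _ ≤ _ := by push_cast; gcongr; linarith

end IsMajorized

/-- The power series of `1 / (b + X)`. -/
noncomputable def invLinear (b : ℝ) : PowerSeries ℝ :=
  PowerSeries.mk fun k => (-1) ^ k / b ^ (k + 1)

theorem C_add_X_mul_invLinear {b : ℝ} (hb : b ≠ 0) :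
    (PowerSeries.C b + PowerSeries.X) * invLinear b = 1 := by
  ext k
  rw [add_mul, map_add, PowerSeries.coeff_C_mul]
  rcases k with _ | k
  · simp [invLinear, hb]
  · rw [PowerSeries.coeff_succ_X_mul]
    simp only [invLinear, PowerSeries.coeff_mk, PowerSeries.coeff_one]
    field_simp
    simp; ring

theorem IsMajorized.invLinear {b : ℝ} (hb : 1 ≤ b) : IsMajorized (invLinear b) b⁻¹ 1 := by
  intro k
  have hb0 : 0 < b := by linarith
  simp only [_root_.invLinear, PowerSeries.coeff_mk, pow_one, abs_div, abs_pow, abs_neg, abs_one,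
    one_pow, abs_of_pos hb0, Pi.one_apply, mul_one, one_div]
  exact inv_anti₀ hb0 (by simpa using pow_le_pow_right₀ hb (show 1 ≤ k + 1 by omega))

section PartialFractions

open Polynomial Finset

theorem prod_range_erase_sub (M k : ℕ) (hk : k ≤ M) :
    ∏ j ∈ (range (M + 1)).erase k, ((j : ℝ) - k) =
      (-1) ^ k * (k.factorial : ℝ) * ((M - k).factorial : ℝ) := by
  induction M, hk using Nat.le_induction with
  | base =>
    have h : (range (k + 1)).erase k = range k := by
      ext j; simp only [mem_erase, mem_range]; omega
    rw [h, Nat.sub_self, Nat.factorial_zero, Nat.cast_one, mul_one]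
    rw [← prod_range_reflect, ← prod_range_add_one_eq_factorial, Nat.cast_prod]
    rw [← card_range k, ← prod_const, card_range, ← prod_mul_distrib]
    refine prod_congr rfl fun j hj => ?_
    have hj' := mem_range.1 hj
    rw [Nat.cast_sub (by omega), Nat.cast_sub (by omega)]
    push_cast; ring
  | succ M hM ih =>
    have h : (range (M + 1 + 1)).erase k = insert (M + 1) ((range (M + 1)).erase k) := by
      ext j; simp only [mem_erase, mem_range, mem_insert]; omega
    rw [h, prod_insert (by simp), ih, Nat.succ_sub hM, Nat.factorial_succ]
    push_cast [Nat.cast_sub hM]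
    ring

/-- Lagrange interpolation at the nodes `-1, -2, …, -(M + 1)`. -/
theorem sum_choose_mul_eval_mul_prod (M : ℕ) (N : ℝ[X]) (hN : N.natDegree ≤ M) :
    ∑ m ∈ range (M + 1), C ((-1) ^ m * (M.choose m : ℝ) * N.eval (-((m : ℝ) + 1))) *
      ∏ j ∈ (range (M + 1)).erase m, (X + C ((j : ℝ) + 1)) = C (M.factorial : ℝ) * N := by
  have hinj : Set.InjOn (fun k : ℕ => -((k : ℝ) + 1)) (range (M + 1)) := by
    intro a _ b _ h
    simpa using h
  have hd : ∀ P : ℝ[X], P.natDegree ≤ M → P.degree < (range (M + 1)).card := by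
    intro P hP
    rw [card_range]
    exact degree_le_natDegree.trans_lt (by exact_mod_cast Nat.lt_succ_of_le hP)
  refine eq_of_degrees_lt_of_eval_index_eq (range (M + 1)) hinj (hd _ ?_) (hd _ ?_) ?_
  · refine natDegree_sum_le_of_forall_le _ _ fun m hm => ?_
    refine (natDegree_C_mul_le _ _).trans ((natDegree_prod_le _ _).trans ?_)
    refine (sum_le_card_nsmul _ _ 1 fun j _ => natDegree_X_add_C _ |>.le).trans ?_
    rw [card_erase_of_mem hm]
    simp
  · exact (natDegree_C_mul_le _ _).trans hN
  · intro k hk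
    have hkM : k ≤ M := by have := mem_range.1 hk; omega
    rw [eval_finsetSum, sum_eq_single_of_mem k hk]
    · simp only [eval_mul, eval_C, eval_prod, eval_add, eval_X]
      have h : ∀ j : ℕ, -((k : ℝ) + 1) + (j + 1) = j - k := fun j => by ring
      simp only [h]
      rw [prod_range_erase_sub M k hkM, ← Nat.choose_mul_factorial_mul_factorial hkM]
      have h1 : ((-1 : ℝ) ^ k) * (-1) ^ k = 1 := by rw [← mul_pow]; simp
      push_cast
      linear_combination ((M.choose k : ℝ) * k.factorial * (M - k).factorial *
        N.eval (-((k : ℝ) + 1))) * h1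
    · intro m _ hmk
      rw [eval_mul, eval_prod]
      refine mul_eq_zero_of_right _ (prod_eq_zero (mem_erase.2 ⟨hmk.symm, hk⟩) (by simp))

theorem coe_X_add_C_comp (u b : ℝ) :
    ((((X + C b).comp (X + C u) : ℝ[X])) : PowerSeries ℝ) =
      PowerSeries.C (u + b) + PowerSeries.X := by
  simp; ring

/-- Clearing denominators in `∑ a_m / (u + m + 1 + X)`. -/
theorem sum_C_mul_invLinear (M : ℕ) (a : ℕ → ℝ) (u : ℝ) (hu : 0 ≤ u) :
    ∑ m ∈ range M, PowerSeries.C (a m) * invLinear (u + (m + 1)) =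
      (((∑ m ∈ range M, C (a m) * ∏ j ∈ (range M).erase m, (X + C ((j : ℝ) + 1))).comp
        (X + C u) : ℝ[X]) : PowerSeries ℝ) * ∏ m ∈ range M, invLinear (u + (m + 1)) := by
  have hb : ∀ m : ℕ, (PowerSeries.C (u + (m + 1)) + PowerSeries.X) * invLinear (u + (m + 1)) = 1 :=
    fun m => C_add_X_mul_invLinear (by positivity)
  rw [← Polynomial.coe_compRingHom_apply, map_sum, ← Polynomial.coeToPowerSeries.ringHom_apply,
    map_sum, sum_mul]
  refine sum_congr rfl fun m hm => ?_
  rw [map_mul, map_prod, map_mul, map_prod, mul_assoc, ← mul_prod_erase _ _ hm]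
  simp only [coe_compRingHom_apply, Polynomial.coeToPowerSeries.ringHom_apply, coe_X_add_C_comp,
    C_comp, coe_C]
  rw [mul_left_comm (∏ _ ∈ _, _), ← prod_mul_distrib, prod_congr rfl fun j _ => hb j]
  simp

theorem partial_fractions (M : ℕ) (N : ℝ[X]) (hN : N.natDegree ≤ M) (u : ℝ) (hu : 0 ≤ u) :
    ∑ m ∈ range (M + 1), PowerSeries.C ((-1) ^ m * (M.choose m : ℝ) * N.eval (-((m : ℝ) + 1))) *
        invLinear (u + (m + 1)) =
      PowerSeries.C (M.factorial : ℝ) * (N.comp (X + C u) : ℝ[X]) *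
        ∏ m ∈ range (M + 1), invLinear (u + (m + 1)) := by
  rw [sum_C_mul_invLinear _ _ _ hu, sum_choose_mul_eval_mul_prod M N hN, mul_comp, C_comp,
    Polynomial.coe_mul, Polynomial.coe_C]

theorem coeff_sum_C_mul_invLinear (M : ℕ) (a : ℕ → ℝ) (u : ℝ) (k : ℕ) :
    (∑ m ∈ range M, PowerSeries.C (a m) * invLinear (u + (m + 1))).coeff k =
      (-1) ^ k * ∑ m ∈ range M, a m / (u + (m + 1)) ^ (k + 1) := by
  rw [map_sum, mul_sum]
  refine sum_congr rfl fun m _ => ?_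
  rw [PowerSeries.coeff_C_mul, invLinear, PowerSeries.coeff_mk]
  ring

/-- A rational function `∑ s_j / (t + j + 1)` with `M` poles and a zero of order `ℓ` at each of
`0, 1, …, n` vanishes identically when `M ≤ ℓ (n + 1)`. -/
theorem eq_zero_of_moments_eq_zero (ℓ n M : ℕ) (hM : M ≤ ℓ * (n + 1)) (a : ℕ → ℝ)
    (h : ∀ u ≤ n, ∀ k < ℓ, ∑ j ∈ range M, a j / ((u : ℝ) + (j + 1)) ^ (k + 1) = 0) :
    ∀ j < M, a j = 0 := by
  intro j₀ hj₀
  set W : ℝ[X] := ∑ m ∈ range M, C (a m) * ∏ j ∈ (range M).erase m, (X + C ((j : ℝ) + 1)) with hW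
  have hdiv : ∀ u ∈ range (n + 1), (X - C (u : ℝ)) ^ ℓ ∣ W := by
    intro u hu
    have hs := sum_C_mul_invLinear M a (u : ℝ) (Nat.cast_nonneg u)
    rw [← hW] at hs
    have hX : (PowerSeries.X : PowerSeries ℝ) ^ ℓ ∣
          ((W.comp (X + C (u : ℝ)) : ℝ[X]) : PowerSeries ℝ) := by
      have hX' : (PowerSeries.X : PowerSeries ℝ) ^ ℓ ∣
          ∑ m ∈ range M, PowerSeries.C (a m) * invLinear ((u : ℝ) + (m + 1)) := by
        rw [PowerSeries.X_pow_dvd_iff]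
        intro k hk
        rw [coeff_sum_C_mul_invLinear, h u (by have := mem_range.1 hu; omega) k hk, mul_zero]
      have hinv : (∏ m ∈ range M, invLinear ((u : ℝ) + (m + 1))) *
          ∏ m ∈ range M, (PowerSeries.C ((u : ℝ) + (m + 1)) + PowerSeries.X) = 1 := by
        rw [← prod_mul_distrib]
        refine prod_eq_one fun m _ => ?_
        rw [mul_comm]
        exact C_add_X_mul_invLinear (by positivity)
      rw [hs] at hX'
      have := hX'.mul_right (∏ m ∈ range M, (PowerSeries.C ((u : ℝ) + (m + 1)) + PowerSeries.X))
      rwa [mul_assoc, hinv, mul_one] at this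
    have hX2 : (X : ℝ[X]) ^ ℓ ∣ W.comp (X + C (u : ℝ)) := by
      rw [PowerSeries.X_pow_dvd_iff] at hX
      rw [Polynomial.X_pow_dvd_iff]
      intro k hk
      simpa using hX k hk
    obtain ⟨V, hV⟩ := hX2
    refine ⟨V.comp (X - C (u : ℝ)), ?_⟩
    have := congrArg (fun P : ℝ[X] => P.comp (X - C (u : ℝ))) hV
    simpa [comp_assoc] using this
  have hprod : (∏ u ∈ range (n + 1), (X - C (u : ℝ)) ^ ℓ) ∣ W := by
    refine prod_dvd_of_coprime ?_ hdiv
    intro u _ v _ huv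
    refine IsCoprime.pow (isCoprime_X_sub_C_of_isUnit_sub ?_)
    exact (sub_ne_zero.2 (by exact_mod_cast huv)).isUnit
  have hW0 : W = 0 := by
    refine eq_zero_of_dvd_of_natDegree_lt hprod ?_
    have h1 : (∏ u ∈ range (n + 1), (X - C (u : ℝ)) ^ ℓ).natDegree = ℓ * (n + 1) := by
      rw [natDegree_prod_of_monic _ _ fun u _ => (monic_X_sub_C _).pow _]
      simp only [natDegree_pow, natDegree_X_sub_C]
      simp [mul_comm]
    have h2 : W.natDegree ≤ M - 1 := by
      refine natDegree_sum_le_of_forall_le _ _ fun m hm => ?_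
      refine (natDegree_C_mul_le _ _).trans ((natDegree_prod_le _ _).trans ?_)
      refine (sum_le_card_nsmul _ _ 1 fun j _ => natDegree_X_add_C _ |>.le).trans ?_
      rw [card_erase_of_mem hm]
      simp
    omega
  have he := congrArg (eval (-((j₀ : ℝ) + 1))) hW0
  have hj₀' := mem_range.2 hj₀
  rw [hW, eval_finsetSum, sum_eq_single_of_mem j₀ hj₀', eval_mul, eval_C, eval_prod, eval_zero,
    mul_eq_zero, prod_eq_zero_iff] at he
  · refine he.resolve_right ?_
    rintro ⟨j, hj, hj'⟩
    refine (mem_erase.1 hj).1 ?_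
    have : (j : ℝ) = j₀ := by simp at hj'; linarith
    exact_mod_cast this
  · intro m _ hm
    rw [eval_mul, eval_prod]
    exact mul_eq_zero_of_right _ (prod_eq_zero (mem_erase.2 ⟨hm.symm, hj₀'⟩) (by simp))

end PartialFractions

section Pade

open Finset

/-- Coefficients of the common denominators of simultaneous Padé approximants to
`Li_1, …, Li_ℓ` at infinity. -/
def padeCoeff (ℓ n i m : ℕ) : ℤ :=
  (-1) ^ m * ((ℓ * (n + 1)).choose m : ℤ) * ((m + n).choose n : ℤ) ^ ℓ * ((m : ℤ) + 1) ^ i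

/-- The coefficients of the expansion at infinity of the Padé remainder for `Li_k`. -/
noncomputable def padeMoment (ℓ n i k s : ℕ) : ℝ :=
  ∑ m ∈ range (ℓ * (n + 1) + 1), (padeCoeff ℓ n i m : ℝ) / ((s : ℝ) + (m + 1)) ^ k

open Polynomial in
/-- The numerator of the rational function `t ↦ ∑ m, padeCoeff ℓ n i m / (t + m + 1)`,
up to a factorial. -/
noncomputable def padeNumerator (ℓ n i : ℕ) : ℝ[X] :=
  C ((-1) ^ (n * ℓ + i) / (n.factorial : ℝ) ^ ℓ) * X ^ i * (∏ j ∈ range n, (X - C (j : ℝ))) ^ ℓ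

theorem natDegree_padeNumerator_le (ℓ n i : ℕ) (hi : i ≤ ℓ) :
    (padeNumerator ℓ n i).natDegree ≤ ℓ * (n + 1) := by
  have h1 : (∏ j ∈ range n, (Polynomial.X - Polynomial.C (j : ℝ))).natDegree ≤ n := by
    rw [Polynomial.natDegree_prod_of_monic _ _ fun u _ => Polynomial.monic_X_sub_C _]
    simp only [Polynomial.natDegree_X_sub_C]
    simp
  refine Polynomial.natDegree_mul_le.trans ?_
  have h2 := Polynomial.natDegree_C_mul_X_pow_le
    ((-1) ^ (n * ℓ + i) / (n.factorial : ℝ) ^ ℓ) i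
  have h3 := Polynomial.natDegree_pow_le_of_le ℓ h1
  calc _ ≤ i + ℓ * n := add_le_add h2 h3
    _ ≤ _ := by rw [mul_add, mul_one]; omega

theorem eval_padeNumerator (ℓ n i m : ℕ) :
    (padeNumerator ℓ n i).eval (-((m : ℝ) + 1)) =
      ((m + n).choose n : ℝ) ^ ℓ * ((m : ℝ) + 1) ^ i := by
  have h : ∏ j ∈ range n, (-((m : ℝ) + 1) - j) =
      (-1) ^ n * ((n.factorial : ℝ) * ((m + n).choose n : ℝ)) := by
    have h2 : (((m + 1).ascFactorial n : ℕ) : ℝ) =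
        (n.factorial : ℝ) * ((m + n).choose n : ℝ) := by
      rw [Nat.ascFactorial_eq_factorial_mul_choose]; push_cast; rfl
    rw [← h2, Nat.ascFactorial_eq_prod_range, Nat.cast_prod]
    nth_rewrite 2 [← card_range n]
    rw [← prod_const, ← prod_mul_distrib]
    refine prod_congr rfl fun j _ => ?_
    push_cast; ring
  have hf : (n.factorial : ℝ) ≠ 0 := by positivity
  simp only [padeNumerator, Polynomial.eval_mul, Polynomial.eval_C, Polynomial.eval_pow,
    Polynomial.eval_X, Polynomial.eval_prod, Polynomial.eval_sub, h]
  have hs : ((-1 : ℝ) ^ (n * ℓ + i)) * ((-1) ^ i * ((-1) ^ n) ^ ℓ) = 1 := by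
    rw [← pow_mul, ← pow_add, ← pow_add, Even.neg_one_pow]
    exact ⟨n * ℓ + i, by ring⟩
  rw [neg_pow ((m : ℝ) + 1), mul_pow, mul_pow]
  field_simp
  linear_combination (((m + n).choose n : ℝ) ^ ℓ) * hs

theorem coe_padeNumerator_comp (ℓ n i : ℕ) (s : ℝ) :
    (((padeNumerator ℓ n i).comp (Polynomial.X + Polynomial.C s) : Polynomial ℝ) :
      PowerSeries ℝ) =
    PowerSeries.C ((-1) ^ (n * ℓ + i) / (n.factorial : ℝ) ^ ℓ) *
      (PowerSeries.C s + PowerSeries.X) ^ i *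
      (∏ j ∈ range n, (PowerSeries.C (s - j) + PowerSeries.X)) ^ ℓ := by
  have h : ∀ b : ℝ, ((((Polynomial.X - Polynomial.C b).comp (Polynomial.X + Polynomial.C s) :
      Polynomial ℝ)) : PowerSeries ℝ) = PowerSeries.C (s - b) + PowerSeries.X := by
    intro b; simp; ring
  rw [padeNumerator, Polynomial.mul_comp, Polynomial.mul_comp, Polynomial.pow_comp,
    Polynomial.pow_comp, Polynomial.prod_comp, Polynomial.C_comp, Polynomial.X_comp]
  simp only [Polynomial.coe_mul, Polynomial.coe_pow, Polynomial.coe_C, Polynomial.coe_add,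
    Polynomial.coe_X]
  rw [← Polynomial.coeToPowerSeries.ringHom_apply (φ := ∏ _ ∈ _, _), map_prod]
  simp only [Polynomial.coeToPowerSeries.ringHom_apply, h]
  rw [add_comm PowerSeries.X]

theorem coeff_padeNumerator_eq (ℓ n i k s : ℕ) (hi : i ≤ ℓ) :
    (PowerSeries.C ((ℓ * (n + 1)).factorial : ℝ) *
      ((padeNumerator ℓ n i).comp (Polynomial.X + Polynomial.C (s : ℝ)) : Polynomial ℝ) *
        ∏ m ∈ range (ℓ * (n + 1) + 1), invLinear ((s : ℝ) + (m + 1))).coeff k =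
      (-1) ^ k * padeMoment ℓ n i (k + 1) s := by
  rw [← partial_fractions _ _ (natDegree_padeNumerator_le ℓ n i hi) _ (Nat.cast_nonneg s),
    coeff_sum_C_mul_invLinear, padeMoment]
  congr 1
  refine sum_congr rfl fun m _ => ?_
  rw [eval_padeNumerator, padeCoeff]
  push_cast
  ring

theorem padeMoment_eq_zero (ℓ n i k s : ℕ) (hi : i ≤ ℓ) (hk : k < ℓ) (hs : s < n) :
    padeMoment ℓ n i (k + 1) s = 0 := by
  have h := coeff_padeNumerator_eq ℓ n i k s hi
  have hdvd : (PowerSeries.X : PowerSeries ℝ) ^ ℓ ∣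
      PowerSeries.C ((ℓ * (n + 1)).factorial : ℝ) *
      ((padeNumerator ℓ n i).comp (Polynomial.X + Polynomial.C (s : ℝ)) : Polynomial ℝ) *
        ∏ m ∈ range (ℓ * (n + 1) + 1), invLinear ((s : ℝ) + (m + 1)) := by
    rw [coe_padeNumerator_comp]
    refine Dvd.dvd.mul_right (Dvd.dvd.mul_left (Dvd.dvd.mul_left (pow_dvd_pow_of_dvd ?_ _) _) _) _
    refine Dvd.dvd.trans ?_ (dvd_prod_of_mem _ (mem_range.2 hs))
    simp
  rw [PowerSeries.X_pow_dvd_iff.1 hdvd k hk] at h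
  simpa using h

theorem abs_padeMoment_le (ℓ n i k s : ℕ) (hi : i ≤ ℓ) (hs : n ≤ s) (hs1 : 1 ≤ s) :
    |padeMoment ℓ n i (k + 1) s| ≤
      (s : ℝ) ^ i * (s.choose n : ℝ) ^ ℓ * (((ℓ * (n + 1)).factorial : ℝ) *
        ∏ m ∈ range (ℓ * (n + 1) + 1), ((s : ℝ) + m + 1)⁻¹) *
          (2 * (ℓ * (n + 1)) + 1 + k : ℝ) ^ k := by
  have h := coeff_padeNumerator_eq ℓ n i k s hi
  have h' : |padeMoment ℓ n i (k + 1) s| = |(-1) ^ k * padeMoment ℓ n i (k + 1) s| := by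
    rw [abs_mul, abs_pow]; simp
  rw [h', ← h, coe_padeNumerator_comp]
  have hprod : ∏ j ∈ range n, ((s : ℝ) - j) = (n.factorial : ℝ) * (s.choose n : ℝ) := by
    rw [← Nat.cast_mul, ← Nat.descFactorial_eq_factorial_mul_choose,
      Nat.descFactorial_eq_prod_range, Nat.cast_prod]
    refine prod_congr rfl fun j hj => ?_
    rw [Nat.cast_sub (by have := mem_range.1 hj; omega)]
  have hmaj := (((IsMajorized.const ((ℓ * (n + 1)).factorial : ℝ)).mul
    (((IsMajorized.const ((-1) ^ (n * ℓ + i) / (n.factorial : ℝ) ^ ℓ)).mul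
      ((IsMajorized.C_add_X (b := (s : ℝ)) (by exact_mod_cast hs1)).pow i)).mul
      ((IsMajorized.prod_range (n := n)
        (F := fun j => PowerSeries.C ((s : ℝ) - j) + PowerSeries.X)
        (c := fun j => (s : ℝ) - j) (fun j hj => IsMajorized.C_add_X (by
          have : ((j + 1 : ℕ) : ℝ) ≤ s := by exact_mod_cast (by omega : j + 1 ≤ s)
          push_cast at this; linarith))).pow ℓ))).mul
    (IsMajorized.prod_range (n := ℓ * (n + 1) + 1)
      (F := fun m => invLinear ((s : ℝ) + (m + 1)))
      (c := fun m => ((s : ℝ) + (m + 1))⁻¹) (fun m _ => IsMajorized.invLinear (by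
          have : (0 : ℝ) ≤ s := by positivity
          have : (0 : ℝ) ≤ m := by positivity
          linarith)))).abs_coeff_le (by omega) k
  have hK : ((0 + (0 + 1 * i + n * ℓ) + (ℓ * (n + 1) + 1) : ℕ) : ℝ) + k ≤
      2 * (ℓ * (n + 1)) + 1 + k := by
    have : (i : ℝ) ≤ ℓ := by exact_mod_cast hi
    push_cast
    linarith
  refine hmaj.trans ((mul_le_mul_of_nonneg_left (pow_le_pow_left₀ (by positivity) hK k)
    ?_).trans_eq ?_)
  · rw [hprod]
    positivity
  · rw [hprod, abs_div, abs_pow, abs_neg, abs_one, one_pow, mul_pow]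
    have hf : (n.factorial : ℝ) ≠ 0 := by positivity
    simp only [add_assoc, Nat.abs_cast, abs_pow]
    field_simp

end Pade

section Approximation

open Finset

/-- The numerators of the simultaneous Padé approximants to `Li_k(1/z)`. -/
noncomputable def padePoly (ℓ n i k : ℕ) (z : ℝ) : ℝ :=
  ∑ m ∈ range (ℓ * (n + 1) + 1),
    (padeCoeff ℓ n i m : ℝ) * ∑ t ∈ range m, z ^ (m - 1 - t) / ((t : ℝ) + 1) ^ k

theorem hasSum_Li_tail (k m : ℕ) (z : ℝ) (hz : 1 < |z|) :
    HasSum (fun s : ℕ => (1 / z) ^ (s + 1) / ((s : ℝ) + (m + 1)) ^ k)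
      (z ^ m * Li k (1 / z) - ∑ t ∈ range m, z ^ (m - 1 - t) / ((t : ℝ) + 1) ^ k) := by
  have hz0 : z ≠ 0 := by rintro rfl; simp at hz; linarith
  have hsum : Summable fun t : ℕ => (1 / z) ^ (t + 1) / ((t : ℝ) + 1) ^ k := by
    have hlt : |1 / z| < 1 := by
      rw [abs_div, abs_one, div_lt_one (by linarith)]; exact hz
    refine Summable.of_norm_bounded
      ((summable_nat_add_iff 1).2 (summable_geometric_of_lt_one (abs_nonneg _) hlt)) fun t => ?_
    rw [norm_div, norm_pow, norm_pow, Real.norm_eq_abs]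
    refine div_le_self (by positivity) (one_le_pow₀ ?_)
    rw [Real.norm_eq_abs, abs_of_nonneg (by positivity)]
    linarith [(Nat.cast_nonneg t : (0 : ℝ) ≤ t)]
  have h1 := ((hasSum_nat_add_iff' m).2 hsum.hasSum).mul_left (z ^ m)
  have hval : z ^ m * Li k (1 / z) - ∑ t ∈ range m, z ^ (m - 1 - t) / ((t : ℝ) + 1) ^ k =
      z ^ m * (∑' t : ℕ, (1 / z) ^ (t + 1) / ((t : ℝ) + 1) ^ k -
        ∑ t ∈ range m, (1 / z) ^ (t + 1) / ((t : ℝ) + 1) ^ k) := by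
    rw [mul_sub, mul_sum, Li]
    congr 1
    refine sum_congr rfl fun t ht => ?_
    have ht' := mem_range.1 ht
    have : z ^ m * (1 / z) ^ (t + 1) = z ^ (m - 1 - t) := by
      conv_lhs => rw [show m = (m - 1 - t) + (t + 1) by omega, pow_add, mul_assoc, ← mul_pow]
      simp [hz0]
    rw [← mul_div_assoc, this]
  rw [hval]
  refine (congrArg (HasSum · _) (funext fun s => ?_)).mpr h1
  have : z ^ m * (1 / z) ^ (s + m + 1) = (1 / z) ^ (s + 1) := by
    rw [show s + m + 1 = m + (s + 1) by ring, pow_add, ← mul_assoc, ← mul_pow]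
    simp [hz0]
  rw [← mul_div_assoc, this]
  push_cast
  ring

theorem hasSum_padeMoment (ℓ n i k : ℕ) (z : ℝ) (hz : 1 < |z|) :
    HasSum (fun s : ℕ => padeMoment ℓ n i k s * (1 / z) ^ (s + 1))
      ((∑ m ∈ range (ℓ * (n + 1) + 1), (padeCoeff ℓ n i m : ℝ) * z ^ m) * Li k (1 / z) -
        padePoly ℓ n i k z) := by
  have h := hasSum_sum (s := range (ℓ * (n + 1) + 1)) fun m _ =>
    (hasSum_Li_tail k m z hz).mul_left (padeCoeff ℓ n i m : ℝ)
  rw [padePoly, sum_mul, ← sum_sub_distrib, sum_congr rfl fun m _ => (by ring :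
    (padeCoeff ℓ n i m : ℝ) * z ^ m * Li k (1 / z) - (padeCoeff ℓ n i m : ℝ) *
        ∑ t ∈ range m, z ^ (m - 1 - t) / ((t : ℝ) + 1) ^ k =
      (padeCoeff ℓ n i m : ℝ) * (z ^ m * Li k (1 / z) -
        ∑ t ∈ range m, z ^ (m - 1 - t) / ((t : ℝ) + 1) ^ k))]
  refine (congrArg (HasSum · _) (funext fun s => ?_)).mpr h
  rw [padeMoment, sum_mul]
  exact sum_congr rfl fun m _ => by ring

theorem exists_int_eq_lcmUpto_pow_mul_padePoly (ℓ n i k : ℕ) (hk : k ≤ ℓ) (z : ℤ) :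
    ∃ b : ℤ, ((Nat.lcmUpto (ℓ * (n + 1)) : ℝ)) ^ ℓ * padePoly ℓ n i k z = b := by
  set d := Nat.lcmUpto (ℓ * (n + 1)) with hd
  have hdvd : ∀ t < ℓ * (n + 1), ∃ c : ℤ, (d : ℝ) ^ ℓ / ((t : ℝ) + 1) ^ k = c := by
    intro t ht
    have h1 : t + 1 ∣ d := by
      have := Finset.dvd_lcm (f := (id : ℕ → ℕ)) (mem_Icc.2 ⟨by omega, ht⟩ : t + 1 ∈ Icc 1 _)
      exact this
    obtain ⟨c, hc⟩ := (pow_dvd_pow_of_dvd h1 k).trans (pow_dvd_pow d hk)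
    refine ⟨c, ?_⟩
    have hc' : (d : ℝ) ^ ℓ = ((t : ℝ) + 1) ^ k * c := by exact_mod_cast hc
    rw [hc']
    push_cast
    field_simp
  choose! c hc using hdvd
  refine ⟨∑ m ∈ range (ℓ * (n + 1) + 1), padeCoeff ℓ n i m *
    ∑ t ∈ range m, z ^ (m - 1 - t) * c t, ?_⟩
  rw [padePoly, mul_sum]
  push_cast
  refine sum_congr rfl fun m hm => ?_
  rw [mul_left_comm, mul_sum]
  congr 1
  refine sum_congr rfl fun t ht => ?_
  rw [← hc t (by have := mem_range.1 ht; have := mem_range.1 hm; omega)]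
  ring

/-- The approximation matrix is nonsingular. -/
theorem eq_zero_of_sum_padePoly_eq_zero (ℓ n : ℕ) (z : ℝ) (c : Fin (ℓ + 1) → ℝ)
    (hQ : ∑ i, c i * ∑ m ∈ range (ℓ * (n + 1) + 1), (padeCoeff ℓ n i m : ℝ) * z ^ m = 0)
    (hP : ∀ k < ℓ, ∑ i, c i * padePoly ℓ n i (k + 1) z = 0) : c = 0 := by
  set M := ℓ * (n + 1) with hM
  set q : ℕ → ℝ := fun m => ∑ i, c i * (padeCoeff ℓ n i m : ℝ) with hq
  set τ : ℕ → ℝ := fun j => ∑ m ∈ Ico j (M + 1), q m * z ^ (m - j) with hτ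
  have hrec : ∀ j ≤ M, q j = τ j - z * τ (j + 1) := by
    intro j hj
    simp only [hτ]
    rw [sum_eq_sum_Ico_succ_bot (by omega), mul_sum, Nat.sub_self, pow_zero, mul_one,
      add_sub_assoc, left_eq_add, sub_eq_zero]
    refine sum_congr rfl fun m hm => ?_
    have := mem_Ico.1 hm
    rw [show m - j = (m - (j + 1)) + 1 by omega, pow_succ]
    ring
  have hτM : τ (M + 1) = 0 := by simp [hτ]
  have hτ0 : τ 0 = 0 := by
    rw [← hQ]
    simp only [hτ, hq, ← range_eq_Ico, mul_sum, sum_mul, Nat.sub_zero]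
    rw [sum_comm]
    exact sum_congr rfl fun i _ => sum_congr rfl fun m _ => by ring
  have hmom : ∀ u ≤ n, ∀ k < ℓ,
      ∑ j ∈ range M, τ (j + 1) / ((u : ℝ) + (j + 1)) ^ (k + 1) = 0 := by
    intro u hu k hk
    induction u with
    | zero =>
      rw [← hP k hk]
      simp only [padePoly, ← hM, hτ, mul_sum, sum_div]
      rw [sum_comm (s := univ)]
      have h1 : ∀ m ∈ range (M + 1), ∑ i, ∑ t ∈ range m, c i * ((padeCoeff ℓ n i m : ℝ) *
          (z ^ (m - 1 - t) / ((t : ℝ) + 1) ^ (k + 1))) =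
          ∑ t ∈ range m, q m * z ^ (m - (t + 1)) / ((0 : ℕ) + ((t : ℝ) + 1)) ^ (k + 1) := by
        intro m _
        rw [sum_comm]
        refine sum_congr rfl fun t _ => ?_
        rw [hq, Nat.sub_sub, add_comm 1 t]
        simp only [sum_mul, sum_div, Nat.cast_zero, zero_add]
        exact sum_congr rfl fun i _ => by ring
      rw [sum_congr rfl h1]
      refine sum_comm' fun t m => ?_
      simp only [mem_range, mem_Ico]
      omega
    | succ u ih =>
      have ih := ih (by omega)
      have h0 : ∑ m ∈ range (M + 1), q m / ((u : ℝ) + (m + 1)) ^ (k + 1) = 0 := by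
        have h2 : ∀ m, q m / ((u : ℝ) + (m + 1)) ^ (k + 1) =
            ∑ i, c i * ((padeCoeff ℓ n i m : ℝ) / ((u : ℝ) + (m + 1)) ^ (k + 1)) := by
          intro m
          simp only [hq, sum_div, mul_div_assoc]
        rw [sum_congr rfl fun m _ => h2 m, sum_comm]
        refine sum_eq_zero fun i _ => ?_
        rw [← mul_sum]
        exact mul_eq_zero_of_right _
          (padeMoment_eq_zero ℓ n i k u (by have := i.2; omega) hk (by omega))
      have h3 : ∑ m ∈ range (M + 1), q m / ((u : ℝ) + (m + 1)) ^ (k + 1) =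
          ∑ m ∈ range (M + 1), τ m / ((u : ℝ) + (m + 1)) ^ (k + 1) -
            z * ∑ m ∈ range (M + 1), τ (m + 1) / ((u : ℝ) + (m + 1)) ^ (k + 1) := by
        rw [mul_sum, ← sum_sub_distrib]
        refine sum_congr rfl fun m hm => ?_
        rw [hrec m (by have := mem_range.1 hm; omega)]
        ring
      rw [h0, sum_range_succ', sum_range_succ (fun m : ℕ =>
        τ (m + 1) / ((u : ℝ) + (m + 1)) ^ (k + 1)), ih, hτM, hτ0] at h3
      simp only [zero_div, add_zero, mul_zero, sub_zero] at h3
      rw [h3]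
      refine sum_congr rfl fun m _ => ?_
      push_cast
      congr 2
      ring
  have hτ1 := eq_zero_of_moments_eq_zero ℓ n M le_rfl (fun j => τ (j + 1)) hmom
  have hτ' : ∀ j ≤ M + 1, τ j = 0 := by
    intro j hj
    rcases j with _ | j
    · exact hτ0
    · rcases (by omega : j < M ∨ j = M) with h | rfl
      · exact hτ1 j h
      · exact hτM
  have hq0 : ∀ m ≤ M, q m = 0 := fun m hm => by
    rw [hrec m hm, hτ' m (by omega), hτ' (m + 1) (by omega), mul_zero, sub_zero]
  refine Matrix.eq_zero_of_forall_index_sum_mul_pow_eq_zero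
    (f := fun m : Fin (ℓ + 1) => ((m : ℕ) : ℝ) + 1) ?_ fun m => ?_
  · intro a b hab
    have : ((a : ℕ) : ℝ) = (b : ℕ) := by simpa using hab
    exact Fin.ext (by exact_mod_cast this)
  · have hmM : (m : ℕ) ≤ M := by
      have := m.2
      have : ℓ * 1 ≤ ℓ * (n + 1) := Nat.mul_le_mul_left _ (by omega)
      omega
    have h := hq0 m hmM
    have hch : ((M.choose m : ℕ) : ℝ) ≠ 0 := by exact_mod_cast (Nat.choose_pos hmM).ne'
    have hch2 : (((m + n : ℕ).choose n : ℕ) : ℝ) ≠ 0 := by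
      exact_mod_cast (Nat.choose_pos (by omega)).ne'
    have hne : ((-1 : ℝ) ^ (m : ℕ) * (M.choose m : ℝ) * (((m : ℕ) + n).choose n : ℝ) ^ ℓ) ≠ 0 := by
      positivity
    refine (mul_eq_zero.1 ?_).resolve_left hne
    rw [← h, hq, mul_sum]
    refine sum_congr rfl fun i _ => ?_
    rw [padeCoeff]
    push_cast
    ring

end Approximation

section Estimates

open Finset Filter

theorem eventually_lcmUpto_le :
    ∀ᶠ M : ℕ in atTop, (Nat.lcmUpto M : ℝ) ≤ (41 / 10 : ℝ) ^ M := by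
  obtain ⟨c, hc⟩ := Chebyshev.psi_sub_theta_le_mul_sqrt
  have hδ : 0 < Real.log (41 / 10) - Real.log 4 :=
    sub_pos.2 (Real.log_lt_log (by norm_num) (by norm_num))
  have hsqrt : Tendsto (fun M : ℕ => √(M : ℝ)) atTop atTop :=
    Real.tendsto_sqrt_atTop.comp tendsto_natCast_atTop_atTop
  filter_upwards [hsqrt.eventually_ge_atTop (c / (Real.log (41 / 10) - Real.log 4))] with M hM
  rw [div_le_iff₀ hδ] at hM
  have h1 := hc M
  have h2 := Chebyshev.theta_le_log4_mul_x (Nat.cast_nonneg (α := ℝ) M)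
  have h3 : c * √(M : ℝ) ≤ (M : ℝ) * (Real.log (41 / 10) - Real.log 4) := by
    nlinarith [Real.sqrt_nonneg (M : ℝ), Real.mul_self_sqrt (Nat.cast_nonneg (α := ℝ) M)]
  have hpos : (0 : ℝ) < Nat.lcmUpto M := by exact_mod_cast Nat.lcmUpto_pos M
  rw [← Real.log_le_log_iff hpos (by positivity), Real.log_pow, ← Chebyshev.psi_eq_log_lcmUpto]
  linarith

theorem pow_add_one_le_mul_pow_pred (ℓ : ℕ) (hℓ : 3 ≤ ℓ) :
    (41 / 10 : ℝ) ^ ℓ + 1 ≤ 171 / 200 * (4 * (ℓ : ℝ)) ^ (ℓ - 1) := by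
  have h : ∀ j : ℕ, (41 / 10 : ℝ) ^ (j + 3) + 1 ≤ 171 / 200 * 12 ^ (j + 2) := by
    intro j
    induction j with
    | zero => norm_num
    | succ j ih =>
      have h1 : (41 / 10 : ℝ) ^ (j + 1 + 3) = 41 / 10 * (41 / 10 : ℝ) ^ (j + 3) := by ring
      have h2 : (12 : ℝ) ^ (j + 1 + 2) = 12 * 12 ^ (j + 2) := by ring
      have h3 : (0 : ℝ) ≤ (41 / 10 : ℝ) ^ (j + 3) := by positivity
      linarith
  obtain ⟨j, rfl⟩ := Nat.exists_eq_add_of_le' hℓ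
  refine (h j).trans ?_
  rw [show j + 3 - 1 = j + 2 by omega]
  gcongr
  push_cast
  linarith [(Nat.cast_nonneg j : (0 : ℝ) ≤ j)]

/-- The size of the integrand governing the Padé remainders. -/
theorem mul_le_of_pow_mul_eq (ℓ : ℕ) (hℓ : 1 ≤ ℓ) (Z x v : ℝ) (hZ2 : 2 ≤ Z)
    (hZ : (4 * (ℓ : ℝ)) ^ (ℓ * (ℓ - 1)) ≤ Z) (hx0 : 0 ≤ x) (hx1 : x ≤ 1) (hv : 0 ≤ v)
    (h : v ^ ℓ * (9 / 10 * Z) = x) :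
    v < 1 ∧ (41 / 10 : ℝ) ^ ℓ * ((1 - x) * v) ≤ 95 / 100 * (1 - v) := by
  have hv1 : v < 1 := by
    by_contra! hv1
    have := one_le_pow₀ hv1 (n := ℓ)
    nlinarith
  refine ⟨hv1, ?_⟩
  rcases (by omega : ℓ = 1 ∨ ℓ = 2 ∨ 3 ≤ ℓ) with rfl | rfl | h3
  · rw [pow_one] at h ⊢
    have hvx : v ≤ x / (9 / 5) := by
      rw [le_div_iff₀ (by norm_num)]
      nlinarith
    nlinarith [sq_nonneg (x - 505 / 820), mul_nonneg (sub_nonneg.2 hx1) (sub_nonneg.2 hvx)]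
  · have hZ' : (64 : ℝ) ≤ Z := by norm_num at hZ; linarith
    have hxv : 288 / 5 * v ^ 2 ≤ x := by nlinarith [sq_nonneg v]
    have h1 : (1 - x) * v ≤ (1 - 288 / 5 * v ^ 2) * v :=
      mul_le_mul_of_nonneg_right (by linarith) hv
    have h2 : 0 ≤ (v - 78 / 1000) ^ 2 * (v + 156 / 1000) :=
      mul_nonneg (sq_nonneg _) (by linarith)
    norm_num
    nlinarith
  · set B : ℝ := 9 / 10 * (4 * (ℓ : ℝ)) ^ (ℓ - 1) with hB
    have hB0 : 0 < B := by positivity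
    have hvB : v * B ≤ 1 := by
      rw [← pow_le_one_iff_of_nonneg (by positivity) (show ℓ ≠ 0 by omega), mul_pow, hB, mul_pow,
        ← pow_mul, mul_comm (ℓ - 1)]
      have h9 : (9 / 10 : ℝ) ^ ℓ ≤ 9 / 10 := pow_le_of_le_one (by norm_num) (by norm_num) (by omega)
      calc _ ≤ v ^ ℓ * (9 / 10 * Z) := by gcongr
        _ ≤ 1 := h.trans_le hx1
    have h4 := pow_add_one_le_mul_pow_pred ℓ h3
    have h5 : (41 / 10 : ℝ) ^ ℓ + 1 ≤ 95 / 100 * B := by rw [hB]; linarith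
    have h6 : (41 / 10 : ℝ) ^ ℓ * ((1 - x) * v) ≤ (41 / 10 : ℝ) ^ ℓ * v := by
      gcongr; nlinarith
    nlinarith

theorem choose_mul_pow_mul_pow_le (s n : ℕ) (hn : n ≤ s) (v : ℝ) (hv : 0 ≤ v) (hv1 : v ≤ 1) :
    (s.choose n : ℝ) * v ^ s * (1 - v) ^ n ≤ v ^ n := by
  have h1 : 0 ≤ 1 - v := by linarith
  have h := single_le_sum (f := fun m => (1 - v) ^ m * v ^ (s - m) * (s.choose m : ℝ))
    (fun m _ => by positivity) (mem_range.2 (by omega : n < s + 1))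
  rw [← add_pow, sub_add_cancel, one_pow] at h
  calc _ = ((1 - v) ^ n * v ^ (s - n) * (s.choose n : ℝ)) * v ^ n := by
        conv_lhs => rw [← Nat.sub_add_cancel hn, pow_add, Nat.sub_add_cancel hn]
        ring
    _ ≤ 1 * v ^ n := by gcongr
    _ = _ := one_mul _

theorem choose_pow_mul_le (ℓ : ℕ) (hℓ : 1 ≤ ℓ) (Z : ℝ) (hZ2 : 2 ≤ Z)
    (hZ : (4 * (ℓ : ℝ)) ^ (ℓ * (ℓ - 1)) ≤ Z) (n s : ℕ) (hn : n ≤ s) (x : ℝ)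
    (hx : x ∈ Set.Icc (0 : ℝ) 1) :
    (s.choose n : ℝ) ^ ℓ * (x ^ s * (1 - x) ^ (ℓ * (n + 1))) ≤
      (9 / 10 * Z) ^ s * (95 / 100 / (41 / 10 : ℝ) ^ ℓ) ^ (ℓ * n) := by
  obtain ⟨hx0, hx1⟩ := hx
  have hY : 0 < 9 / 10 * Z := by linarith
  obtain ⟨v, hv, hvx⟩ : ∃ v : ℝ, 0 ≤ v ∧ v ^ ℓ * (9 / 10 * Z) = x := by
    refine ⟨(x / (9 / 10 * Z)) ^ ((ℓ : ℝ)⁻¹), by positivity, ?_⟩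
    rw [Real.rpow_inv_natCast_pow (by positivity) (by omega)]
    field_simp
  obtain ⟨hv1, hle⟩ := mul_le_of_pow_mul_eq ℓ hℓ Z x v hZ2 hZ hx0 hx1 hv hvx
  have hv1' : 0 < 1 - v := by linarith
  have hx1' : 0 ≤ 1 - x := by linarith
  have hc := choose_mul_pow_mul_pow_le s n hn v hv hv1.le
  have hq : (1 - x) * (v / (1 - v)) ≤ 95 / 100 / (41 / 10 : ℝ) ^ ℓ := by
    rw [le_div_iff₀ (by positivity), ← mul_div_assoc, div_mul_eq_mul_div, div_le_iff₀ hv1']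
    linarith
  have hc' : (s.choose n : ℝ) * v ^ s ≤ (v / (1 - v)) ^ n := by
    rw [div_pow, le_div_iff₀ (by positivity)]
    exact hc
  have h1 : (1 - x) ^ (ℓ * (n + 1)) ≤ (1 - x) ^ (ℓ * n) :=
    pow_le_pow_of_le_one hx1' (by linarith) (Nat.mul_le_mul_left _ (by omega))
  calc (s.choose n : ℝ) ^ ℓ * (x ^ s * (1 - x) ^ (ℓ * (n + 1)))
      ≤ (s.choose n : ℝ) ^ ℓ * (x ^ s * (1 - x) ^ (ℓ * n)) := by gcongr
    _ = (9 / 10 * Z) ^ s * (((s.choose n : ℝ) * v ^ s) ^ ℓ * (1 - x) ^ (ℓ * n)) := by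
        have hxs : x ^ s = v ^ (ℓ * s) * (9 / 10 * Z) ^ s := by
          rw [← hvx, mul_pow, ← pow_mul]
        rw [hxs, mul_pow (s.choose n : ℝ), ← pow_mul, mul_comm s ℓ]
        ring
    _ ≤ (9 / 10 * Z) ^ s * (((v / (1 - v)) ^ n) ^ ℓ * (1 - x) ^ (ℓ * n)) := by gcongr
    _ = (9 / 10 * Z) ^ s * ((1 - x) * (v / (1 - v))) ^ (ℓ * n) := by
        rw [mul_pow (1 - x), ← pow_mul, mul_comm n ℓ]
        ring
    _ ≤ _ := by gcongr

theorem abs_padeMoment_mul_le (ℓ : ℕ) (hℓ : 1 ≤ ℓ) (z : ℝ) (hZ2 : 2 ≤ |z|)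
    (hZ : (4 * (ℓ : ℝ)) ^ (ℓ * (ℓ - 1)) ≤ |z|) (n i k s : ℕ) (hn : 1 ≤ n) (hi : i ≤ ℓ)
    (hk : k < ℓ) :
    |padeMoment ℓ n i (k + 1) s * (1 / z) ^ (s + 1)| ≤
      (2 * (ℓ * (n + 1)) + 1 + ℓ : ℝ) ^ ℓ * (95 / 100 / (41 / 10 : ℝ) ^ ℓ) ^ (ℓ * n) *
        ((s : ℝ) ^ ℓ * (9 / 10) ^ s) := by
  rcases lt_or_ge s n with hs | hs
  · rw [padeMoment_eq_zero ℓ n i k s hi hk hs, zero_mul, abs_zero]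
    positivity
  have hs1 : (1 : ℝ) ≤ s := by exact_mod_cast hn.trans hs
  have hz0 : 0 < |z| := by linarith
  obtain ⟨x, hx, hbeta⟩ := exists_factorial_mul_prod_inv_le s (ℓ * (n + 1))
  have h1 := abs_padeMoment_le ℓ n i k s hi hs (hn.trans hs)
  have h2 := choose_pow_mul_le ℓ hℓ |z| hZ2 hZ n s hs x hx
  have h3 : (2 * (ℓ * (n + 1)) + 1 + k : ℝ) ^ k ≤ (2 * (ℓ * (n + 1)) + 1 + ℓ : ℝ) ^ ℓ := by
    have hkℓ : (k : ℝ) ≤ ℓ := by exact_mod_cast hk.le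
    calc _ ≤ (2 * (ℓ * (n + 1)) + 1 + ℓ : ℝ) ^ k := by gcongr
      _ ≤ _ := pow_le_pow_right₀ (by
        have : (0 : ℝ) ≤ 2 * (ℓ * (n + 1)) + ℓ := by positivity
        linarith) hk.le
  have h4 : (s : ℝ) ^ i ≤ (s : ℝ) ^ ℓ := pow_le_pow_right₀ hs1 hi
  have h5 : |(1 / z) ^ (s + 1)| ≤ (1 / |z|) ^ s := by
    rw [abs_pow, abs_div, abs_one]
    exact pow_le_pow_of_le_one (by positivity) (by rw [div_le_one hz0]; linarith) (by omega)
  have h6 : |padeMoment ℓ n i (k + 1) s| ≤ (s : ℝ) ^ ℓ * ((9 / 10 * |z|) ^ s *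
      (95 / 100 / (41 / 10 : ℝ) ^ ℓ) ^ (ℓ * n)) * (2 * (ℓ * (n + 1)) + 1 + ℓ : ℝ) ^ ℓ := by
    refine h1.trans ?_
    rw [mul_assoc ((s : ℝ) ^ i)]
    have h7 := (mul_le_mul_of_nonneg_left hbeta
      (by positivity : 0 ≤ (s.choose n : ℝ) ^ ℓ)).trans h2
    exact mul_le_mul (mul_le_mul h4 h7 (by positivity) (by positivity)) h3 (by positivity)
      (by positivity)
  rw [abs_mul]
  calc _ ≤ ((s : ℝ) ^ ℓ * ((9 / 10 * |z|) ^ s * (95 / 100 / (41 / 10 : ℝ) ^ ℓ) ^ (ℓ * n)) *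
        (2 * (ℓ * (n + 1)) + 1 + ℓ : ℝ) ^ ℓ) * (1 / |z|) ^ s := by gcongr
    _ = (2 * (ℓ * (n + 1)) + 1 + ℓ : ℝ) ^ ℓ * (95 / 100 / (41 / 10 : ℝ) ^ ℓ) ^ (ℓ * n) *
        ((s : ℝ) ^ ℓ * ((9 / 10 * |z|) ^ s * (1 / |z|) ^ s)) := by ring
    _ = _ := by
      rw [← mul_pow]
      congr 3
      field_simp

theorem exists_lcmUpto_pow_mul_abs_remainder_lt (ℓ : ℕ) (hℓ : 1 ≤ ℓ) (z : ℝ) (hZ2 : 2 ≤ |z|)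
    (hZ : (4 * (ℓ : ℝ)) ^ (ℓ * (ℓ - 1)) ≤ |z|) (ε : ℝ) (hε : 0 < ε) :
    ∃ n : ℕ, ∀ i ≤ ℓ, ∀ k < ℓ, (Nat.lcmUpto (ℓ * (n + 1)) : ℝ) ^ ℓ *
      |(∑ m ∈ range (ℓ * (n + 1) + 1), (padeCoeff ℓ n i m : ℝ) * z ^ m) * Li (k + 1) (1 / z) -
        padePoly ℓ n i (k + 1) z| < ε := by
  have hsum : Summable fun s : ℕ => (s : ℝ) ^ ℓ * (9 / 10 : ℝ) ^ s :=
    summable_pow_mul_geometric_of_norm_lt_one ℓ (by norm_num [abs_of_pos])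
  set A := ∑' s : ℕ, (s : ℝ) ^ ℓ * (9 / 10 : ℝ) ^ s with hA
  have hA0 : 0 ≤ A := tsum_nonneg fun s => by positivity
  set r : ℝ := (95 / 100 : ℝ) ^ ℓ with hr
  have hr0 : 0 < r := by positivity
  have hr1 : r < 1 := pow_lt_one₀ (by norm_num) (by norm_num) (by omega)
  have hlim : Tendsto (fun n : ℕ => A * (41 / 10 : ℝ) ^ (ℓ * ℓ) * (4 * ℓ : ℝ) ^ ℓ * r⁻¹ *
      (((n + 1 : ℕ) : ℝ) ^ ℓ * r ^ (n + 1))) atTop (nhds 0) := by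
    have h := ((tendsto_pow_const_mul_const_pow_of_abs_lt_one ℓ
      (by rwa [abs_of_pos hr0])).comp (tendsto_add_atTop_nat 1)).const_mul
        (A * (41 / 10 : ℝ) ^ (ℓ * ℓ) * (4 * ℓ : ℝ) ^ ℓ * r⁻¹)
    simpa using h
  have hM : Tendsto (fun n : ℕ => ℓ * (n + 1)) atTop atTop :=
    tendsto_atTop_mono (fun n => by show n ≤ ℓ * (n + 1); nlinarith) tendsto_id
  obtain ⟨n, hn, hnd, hn1⟩ := ((hlim.eventually_lt_const hε).and
    ((hM.eventually eventually_lcmUpto_le).and (eventually_ge_atTop 1))).exists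
  refine ⟨n, fun i hi k hk => lt_of_le_of_lt ?_ hn⟩
  have hbound := fun s => abs_padeMoment_mul_le ℓ hℓ z hZ2 hZ n i k s hn1 hi hk
  have hrem := hasSum_padeMoment ℓ n i (k + 1) z (by linarith)
  rw [← hrem.tsum_eq, ← Real.norm_eq_abs]
  have h1 := tsum_of_norm_bounded
    (f := fun s => padeMoment ℓ n i (k + 1) s * (1 / z) ^ (s + 1))
    (hsum.hasSum.mul_left ((2 * (ℓ * (n + 1)) + 1 + ℓ : ℝ) ^ ℓ *
      (95 / 100 / (41 / 10 : ℝ) ^ ℓ) ^ (ℓ * n))) hbound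
  have h2 : (2 * (ℓ * (n + 1)) + 1 + ℓ : ℝ) ^ ℓ ≤ (4 * ℓ : ℝ) ^ ℓ * ((n + 1 : ℕ) : ℝ) ^ ℓ := by
    rw [← mul_pow]
    have hℓ' : (1 : ℝ) ≤ ℓ := by exact_mod_cast hℓ
    have hn' : (0 : ℝ) ≤ n := Nat.cast_nonneg n
    gcongr
    push_cast
    nlinarith
  have h3 : ∀ p q : ℝ, p ≠ 0 → q ≠ 0 → (p ^ (ℓ * (n + 1))) ^ ℓ * (q / p ^ ℓ) ^ (ℓ * n) =
      p ^ (ℓ * ℓ) * ((q ^ ℓ)⁻¹ * (q ^ ℓ) ^ (n + 1)) := by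
    intro p q hp hq
    rw [div_pow, ← pow_mul, ← pow_mul p ℓ, pow_succ (q ^ ℓ) n, ← pow_mul q,
      show ℓ * (n + 1) * ℓ = ℓ * ℓ + ℓ * (ℓ * n) by ring, pow_add]
    field_simp
  calc _ ≤ ((41 / 10 : ℝ) ^ (ℓ * (n + 1))) ^ ℓ * ((4 * ℓ : ℝ) ^ ℓ * ((n + 1 : ℕ) : ℝ) ^ ℓ *
        (95 / 100 / (41 / 10 : ℝ) ^ ℓ) ^ (ℓ * n) * A) := by
        refine mul_le_mul (pow_le_pow_left₀ (by positivity) hnd ℓ) (h1.trans ?_)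
          (norm_nonneg _) (by positivity)
        gcongr
    _ = _ := by
      linear_combination ((4 * ℓ : ℝ) ^ ℓ * ((n + 1 : ℕ) : ℝ) ^ ℓ * A) *
        h3 (41 / 10) (95 / 100) (by norm_num) (by norm_num)

end Estimates

section LinearIndependence

open Finset Matrix

/-- The matrix of denominators (first column) and numerators of the Padé approximants. -/
noncomputable def padeMatrix (ℓ n : ℕ) (z : ℝ) : Matrix (Fin (ℓ + 1)) (Fin (ℓ + 1)) ℝ :=
  fun i => Fin.cons (∑ m ∈ range (ℓ * (n + 1) + 1), (padeCoeff ℓ n i m : ℝ) * z ^ m)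
    fun k => padePoly ℓ n i (k + 1) z

theorem det_padeMatrix_ne_zero (ℓ n : ℕ) (z : ℝ) : (padeMatrix ℓ n z).det ≠ 0 := by
  intro hdet
  obtain ⟨c, hc, h⟩ := Matrix.exists_vecMul_eq_zero_iff.2 hdet
  refine hc (eq_zero_of_sum_padePoly_eq_zero ℓ n z c ?_ fun k hk => ?_)
  · simpa [vecMul, dotProduct, padeMatrix] using congrFun h 0
  · simpa only [vecMul, dotProduct, padeMatrix, Fin.cons_succ, Pi.zero_apply] using
      congrFun h (Fin.succ ⟨k, hk⟩)

theorem exists_int_eq_mul_padeMatrix_mulVec (ℓ n : ℕ) (z : ℤ) (a : Fin (ℓ + 1) → ℤ)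
    (i : Fin (ℓ + 1)) :
    ∃ b : ℤ, (Nat.lcmUpto (ℓ * (n + 1)) : ℝ) ^ ℓ *
      (padeMatrix ℓ n z *ᵥ fun j => (a j : ℝ)) i = b := by
  choose b hb using fun k : Fin ℓ =>
    exists_int_eq_lcmUpto_pow_mul_padePoly ℓ n i (k + 1) (by omega) z
  refine ⟨(Nat.lcmUpto (ℓ * (n + 1)) : ℤ) ^ ℓ *
    (∑ m ∈ range (ℓ * (n + 1) + 1), padeCoeff ℓ n i m * z ^ m) * a 0 +
      ∑ k : Fin ℓ, b k * a k.succ, ?_⟩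
  simp only [mulVec, dotProduct, padeMatrix, Fin.sum_univ_succ, Fin.cons_zero, Fin.cons_succ,
    Int.cast_add, Int.cast_mul, Int.cast_pow, Int.cast_sum, Int.cast_natCast, ← hb]
  rw [mul_add, mul_assoc, mul_sum univ]
  simp only [mul_assoc]

theorem eq_zero_of_padeMatrix_mulVec_lt_one (ℓ n : ℕ) (z : ℤ) (a : Fin (ℓ + 1) → ℤ)
    (h : ∀ i, (Nat.lcmUpto (ℓ * (n + 1)) : ℝ) ^ ℓ *
      |(padeMatrix ℓ n z *ᵥ fun j => (a j : ℝ)) i| < 1) : a = 0 := by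
  have hd : (0 : ℝ) < (Nat.lcmUpto (ℓ * (n + 1)) : ℝ) ^ ℓ :=
    pow_pos (by exact_mod_cast Nat.lcmUpto_pos _) _
  have h0 : (padeMatrix ℓ n z *ᵥ fun j => (a j : ℝ)) = 0 := by
    ext i
    obtain ⟨b, hb⟩ := exists_int_eq_mul_padeMatrix_mulVec ℓ n z a i
    have hlt := h i
    rw [← abs_of_pos hd, ← abs_mul, hb] at hlt
    have hb0 : b = 0 := Int.abs_lt_one_iff.1 (by exact_mod_cast hlt)
    rw [hb0, Int.cast_zero] at hb
    exact (mul_eq_zero.1 hb).resolve_left hd.ne'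
  have h1 := Matrix.eq_zero_of_mulVec_eq_zero (det_padeMatrix_ne_zero ℓ n z) h0
  ext j
  exact Int.cast_eq_zero.1 (congrFun h1 j)

end LinearIndependence

/-- (Nikishin) If `z` is a negative integer with `|z| > (4ℓ)^{ℓ(ℓ-1)}`, then the
`ℓ+1` numbers `1, Li₁(1/z), …, Li_ℓ(1/z)` are linearly independent over ℚ. -/
theorem nikishin (ℓ : ℕ) (hℓ : 1 ≤ ℓ) (z : ℤ) (hz : z < 0)
    (hbig : ((4 * ℓ : ℕ) ^ (ℓ * (ℓ - 1)) : ℤ) < |z|) :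
    LinearIndependent ℚ
      (fun i : Fin (ℓ + 1) =>
        if (i : ℕ) = 0 then (1 : ℝ) else Li (i : ℕ) (1 / (z : ℝ))) := by
  have hone : (1 : ℤ) ≤ (4 * ℓ : ℕ) ^ (ℓ * (ℓ - 1)) := one_le_pow₀ (by push_cast; omega)
  have hZ2 : (2 : ℝ) ≤ |(z : ℝ)| := by exact_mod_cast (by omega : (2 : ℤ) ≤ |z|)
  have hZ : (4 * (ℓ : ℝ)) ^ (ℓ * (ℓ - 1)) ≤ |(z : ℝ)| := by exact_mod_cast hbig.le
  rw [← LinearIndependent.iff_fractionRing ℤ ℚ, Fintype.linearIndependent_iff]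
  intro a ha
  have hS : 0 < ∑ k : Fin ℓ, |(a k.succ : ℝ)| + 1 := by positivity
  obtain ⟨n, hn⟩ := exists_lcmUpto_pow_mul_abs_remainder_lt ℓ hℓ z hZ2 hZ _ (inv_pos.2 hS)
  refine congrFun (eq_zero_of_padeMatrix_mulVec_lt_one ℓ n z a fun i => ?_)
  set d : ℝ := (Nat.lcmUpto (ℓ * (n + 1)) : ℝ) ^ ℓ
  set Q : ℝ := ∑ m ∈ Finset.range (ℓ * (n + 1) + 1), (padeCoeff ℓ n i m : ℝ) * (z : ℝ) ^ m with hQ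
  have hd : 0 ≤ d := by positivity
  have hR : (padeMatrix ℓ n z).mulVec (fun j => (a j : ℝ)) i =
      -∑ k : Fin ℓ, (a k.succ : ℝ) *
        (Q * Li (k + 1) (1 / (z : ℝ)) - padePoly ℓ n i (k + 1) z) := by
    have ha' : (a 0 : ℝ) + ∑ k : Fin ℓ, (a k.succ : ℝ) * Li (k + 1) (1 / (z : ℝ)) = 0 := by
      simpa [Fin.sum_univ_succ] using ha
    have hlin : ∑ k : Fin ℓ, (a k.succ : ℝ) *
        (Q * Li (k + 1) (1 / (z : ℝ)) - padePoly ℓ n i (k + 1) z) =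
        Q * ∑ k : Fin ℓ, (a k.succ : ℝ) * Li (k + 1) (1 / (z : ℝ)) -
          ∑ k : Fin ℓ, padePoly ℓ n i (k + 1) z * (a k.succ : ℝ) := by
      rw [Finset.mul_sum, ← Finset.sum_sub_distrib]
      exact Finset.sum_congr rfl fun k _ => by ring
    simp only [Matrix.mulVec, dotProduct, padeMatrix, Fin.sum_univ_succ, Fin.cons_zero,
      Fin.cons_succ, ← hQ]
    rw [hlin]
    linear_combination Q * ha'
  calc d * |(padeMatrix ℓ n z).mulVec (fun j => (a j : ℝ)) i|
      ≤ d * ∑ k : Fin ℓ, |(a k.succ : ℝ)| *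
          |Q * Li (k + 1) (1 / (z : ℝ)) - padePoly ℓ n i (k + 1) z| := by
        rw [hR, abs_neg]
        gcongr
        exact (Finset.abs_sum_le_sum_abs _ _).trans_eq
          (Finset.sum_congr rfl fun k _ => abs_mul _ _)
    _ = ∑ k : Fin ℓ, |(a k.succ : ℝ)| *
          (d * |Q * Li (k + 1) (1 / (z : ℝ)) - padePoly ℓ n i (k + 1) z|) := by
        rw [Finset.mul_sum]
        exact Finset.sum_congr rfl fun k _ => by ring
    _ ≤ ∑ k : Fin ℓ, |(a k.succ : ℝ)| * (∑ k : Fin ℓ, |(a k.succ : ℝ)| + 1)⁻¹ := by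
        gcongr with k
        exact (hn i (by omega) k k.2).le
    _ < 1 := by
        rw [← Finset.sum_mul, ← div_eq_mul_inv, div_lt_one hS]
        linarith
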